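/- arXiv:1805.05996 — 2 statements merged into one kernel-verified Lean document; each statement's English description precedes it below -/
import Mathlib

section
/- Let G be a Δ-critical simple graph, ε ∈ (0,1), q = (1−ε)Δ, and let xy ∈ E(G) with d(x) < εΔ and φ ∈ C^Δ(G−xy). If |B_φ(x,y,q)| = 1 and there exists z ∈ N(x, M_φ) with φ_b(z) ∩ B_φ(x,y,q) ≠ ∅, then for every z' ∈ N(x, B_φ) and every u ∈ N(z')−{x}, one has d(u) ≥ q. -/
open Finset

variable {V : Type*}

/-- `φ` is a proper edge coloring of `G` with colors in `{1, …, k}`, encoded as a symmetric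
function on ordered pairs of vertices: every edge receives a color in `[1,k]` and two distinct
edges sharing a vertex receive different colors. -/
def IsEdgeColoring (G : SimpleGraph V) (k : ℕ) (φ : V → V → ℕ) : Prop :=
  (∀ u v, φ u v = φ v u) ∧
  (∀ ⦃u v⦄, G.Adj u v → φ u v ∈ Finset.Icc 1 k) ∧
  (∀ ⦃v a b⦄, G.Adj v a → G.Adj v b → a ≠ b → φ v a ≠ φ v b)

/-- The chromatic index of `G`: the least `k` such that `G` has a proper edge `k`-coloring. -/
noncomputable def chromIndex (G : SimpleGraph V) : ℕ :=
  sInf {k | ∃ φ : V → V → ℕ, IsEdgeColoring G k φ}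

/-- `G` is `Δ`-critical: `G` is connected, `χ'(G) = Δ + 1`, and `χ'(G - e) = Δ` for every
edge `e` of `G`, where `Δ` is the maximum degree of `G`. -/
def IsDeltaCritical [Fintype V] (G : SimpleGraph V) [DecidableRel G.Adj] : Prop :=
  G.Connected ∧ chromIndex G = G.maxDegree + 1 ∧
    ∀ e ∈ G.edgeSet, chromIndex (G.deleteEdges {e}) = G.maxDegree

/-- The independence number of `G`. -/
noncomputable def indepNum [Fintype V] (G : SimpleGraph V) : ℕ :=
  sSup {n | ∃ s : Finset V, (∀ u ∈ s, ∀ v ∈ s, u ≠ v → ¬ G.Adj u v) ∧ s.card = n}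

/-- The set of colors present at `v` in the graph `H` under the coloring `φ`. -/
def present (H : SimpleGraph V) (φ : V → V → ℕ) (v : V) : Set ℕ :=
  {c | ∃ u, H.Adj v u ∧ φ v u = c}

/-- The set of colors in `[1,Δ]` missing at `v` in the graph `H` under the coloring `φ`. -/
def missing (H : SimpleGraph V) (Δ : ℕ) (φ : V → V → ℕ) (v : V) : Set ℕ :=
  Set.Icc 1 Δ \ present H φ v

variable [Fintype V]

/-- `A_φ(x,y,q)`: colors `α` present at `x` such that some colored edge `yu` has color `α`
with `d(u) < q` (degrees taken in `G`, the coloring living on `H = G - xy`). -/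
def Aset (G H : SimpleGraph V) [DecidableRel G.Adj] (φ : V → V → ℕ) (q : ℝ) (x y : V) :
    Set ℕ :=
  {α | α ∈ present H φ x ∧ ∃ u, H.Adj y u ∧ φ y u = α ∧ (G.degree u : ℝ) < q}

/-- `B_φ(x,y,q)`: colors `β` present at `x` such that some colored edge `yu` has color `β`
with `d(u) ≥ q`. -/
def Bset (G H : SimpleGraph V) [DecidableRel G.Adj] (φ : V → V → ℕ) (q : ℝ) (x y : V) :
    Set ℕ :=
  {β | β ∈ present H φ x ∧ ∃ u, H.Adj y u ∧ φ y u = β ∧ q ≤ (G.degree u : ℝ)}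

/-- `M_φ(x,y,q) = A_φ(x,y,q) ∪ φ̄(x) ∪ φ̄(y)`. -/
def Mset (G H : SimpleGraph V) [DecidableRel G.Adj] (Δ : ℕ) (φ : V → V → ℕ) (q : ℝ)
    (x y : V) : Set ℕ :=
  Aset G H φ q x y ∪ missing H Δ φ x ∪ missing H Δ φ y

/-- `N(x, M_φ)`: neighbors `z` of `x` (in `H = G - xy`) with `φ(xz) ∈ M_φ(x,y,q)`. -/
def NxM (G H : SimpleGraph V) [DecidableRel G.Adj] (Δ : ℕ) (φ : V → V → ℕ) (q : ℝ)
    (x y : V) : Set V :=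
  {z | H.Adj x z ∧ φ x z ∈ Mset G H Δ φ q x y}

/-- `N(x, B_φ)`: neighbors `z` of `x` (in `H = G - xy`) with `φ(xz) ∈ B_φ(x,y,q)`. -/
def NxB (G H : SimpleGraph V) [DecidableRel G.Adj] (φ : V → V → ℕ) (q : ℝ) (x y : V) :
    Set V :=
  {z | H.Adj x z ∧ φ x z ∈ Bset G H φ q x y}

/-- `φ_b(v)`: colors `α ∈ [1,Δ]` that are either missing at `v`, or appear on a colored edge
`vv'` with `d(v') < q`. -/
def phib (G H : SimpleGraph V) [DecidableRel G.Adj] (Δ : ℕ) (φ : V → V → ℕ) (q : ℝ)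
    (v : V) : Set ℕ :=
  {α | α ∈ Set.Icc 1 Δ ∧
    (α ∉ present H φ v ∨ ∃ v', H.Adj v v' ∧ φ v v' = α ∧ (G.degree v' : ℝ) < q)}

/-- Color `c` does not occur on the edges of `H` at `v`. -/
def Miss {W : Type*} (H : SimpleGraph W) (φ : W → W → ℕ) (v : W) (c : ℕ) : Prop :=
  ∀ u, H.Adj v u → φ v u ≠ c

/-- `G` minus the edge `xy`. -/
def del {W : Type*} (G : SimpleGraph W) (x y : W) : SimpleGraph W := G.deleteEdges {s(x, y)}

lemma del_adj {W : Type*} {G : SimpleGraph W} {x y a b : W} :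
    (del G x y).Adj a b ↔ G.Adj a b ∧ s(a, b) ≠ s(x, y) := by
  simp [del, SimpleGraph.deleteEdges_adj]

lemma three_ends {W : Type*} [Fintype W] (K : SimpleGraph W) [DecidableRel K.Adj]
    (hK : K.Connected) (h2 : ∀ v, K.degree v ≤ 2) (a b c : W) (hab : a ≠ b) (hac : a ≠ c)
    (hbc : b ≠ c) (ha : K.degree a ≤ 1) (hb : K.degree b ≤ 1) (hc : K.degree c ≤ 1) : False := by
  classical
  have h1 := hK.card_vert_le_card_edgeSet_add_one
  have hs := K.sum_degrees_eq_twice_card_edges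
  have hle : ∑ v, (K.degree v + (if v ∈ ({a, b, c} : Finset W) then 1 else 0)) ≤ ∑ v : W, 2 := by
    apply Finset.sum_le_sum
    intro v _
    have := h2 v
    split_ifs with h
    · simp only [Finset.mem_insert, Finset.mem_singleton] at h
      rcases h with rfl | rfl | rfl <;> omega
    · omega
  rw [Finset.sum_add_distrib, hs, Finset.sum_ite_mem, Finset.univ_inter] at hle
  have h3 : ({a, b, c} : Finset W).card = 3 := by
    rw [Finset.card_eq_three]; exact ⟨a, b, c, hab, hac, hbc, rfl⟩
  simp only [Finset.sum_const, smul_eq_mul, h3, Finset.card_univ] at hle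
  rw [Nat.card_eq_fintype_card, Nat.card_eq_fintype_card, ← SimpleGraph.edgeFinset_card] at h1
  omega

/-- The Kempe graph of the colors `a`, `b`. -/
def kempe {W : Type*} (H : SimpleGraph W) (φ : W → W → ℕ) (hs : ∀ u v, φ u v = φ v u)
    (a b : ℕ) : SimpleGraph W where
  Adj u v := H.Adj u v ∧ (φ u v = a ∨ φ u v = b)
  symm := ⟨fun u v h => ⟨h.1.symm, by rw [hs v u]; exact h.2⟩⟩
  loopless := ⟨fun u h => H.loopless.irrefl u h.1⟩

lemma kempe_three {W : Type*} [Fintype W] (H : SimpleGraph W) (k : ℕ) (φ : W → W → ℕ)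
    (hφ : IsEdgeColoring H k φ) (a b : ℕ) (x y w : W) (hxy : x ≠ y) (hxw : x ≠ w) (hyw : y ≠ w)
    (hx : Miss H φ x a ∨ Miss H φ x b) (hy : Miss H φ y a ∨ Miss H φ y b)
    (hw : Miss H φ w a ∨ Miss H φ w b)
    (r1 : (kempe H φ hφ.1 a b).Reachable w x) (r2 : (kempe H φ hφ.1 a b).Reachable w y) :
    False := by
  classical
  set K := kempe H φ hφ.1 a b with hK
  let S : Set W := (K.connectedComponentMk w).supp
  have hc : (K.induce S).Connected := (K.connectedComponentMk w).connected_toSimpleGraph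
  have mem : ∀ v, K.Reachable w v → v ∈ S := fun v h =>
    SimpleGraph.ConnectedComponent.sound h.symm
  have inj : ∀ v : S, Set.InjOn (fun u : S => φ v u) ((K.induce S).neighborFinset v) := by
    intro v p hp r hr hpr
    by_contra hne
    simp only [Finset.mem_coe, SimpleGraph.mem_neighborFinset] at hp hr
    exact hφ.2.2 hp.1 hr.1 (fun h => hne (Subtype.ext h)) hpr
  have h2 : ∀ v, (K.induce S).degree v ≤ 2 := by
    intro v
    refine (Finset.card_le_card_of_injOn (t := {a, b}) (fun u : S => φ v u) ?_ (inj v)).trans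
      Finset.card_le_two
    intro u hu
    simp only [Finset.mem_coe, SimpleGraph.mem_neighborFinset] at hu
    have := hu.2
    simpa using this
  have h1 : ∀ v : S, (Miss H φ v a ∨ Miss H φ v b) → (K.induce S).degree v ≤ 1 := by
    intro v hv
    rcases hv with hv | hv
    · refine (Finset.card_le_card_of_injOn (t := {b}) (fun u : S => φ v u) ?_ (inj v)).trans
        (by simp)
      intro u hu
      simp only [Finset.mem_coe, SimpleGraph.mem_neighborFinset] at hu
      have := hu.2.resolve_left (hv _ hu.1)
      simpa using this
    · refine (Finset.card_le_card_of_injOn (t := {a}) (fun u : S => φ v u) ?_ (inj v)).trans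
        (by simp)
      intro u hu
      simp only [Finset.mem_coe, SimpleGraph.mem_neighborFinset] at hu
      have := hu.2.resolve_right (hv _ hu.1)
      simpa using this
  exact three_ends (K.induce S) hc h2 ⟨x, mem x r1⟩ ⟨y, mem y r2⟩
    ⟨w, mem w (SimpleGraph.Reachable.refl _)⟩
    (by simpa using hxy) (by simpa using hxw) (by simpa using hyw) (h1 _ hx) (h1 _ hy) (h1 _ hw)

/-- Kempe change on the component of `w`. -/
lemma kempe_change {W : Type*} (H : SimpleGraph W) (k : ℕ) (φ : W → W → ℕ)
    (hφ : IsEdgeColoring H k φ) (a b : ℕ) (ha : a ∈ Finset.Icc 1 k) (hb : b ∈ Finset.Icc 1 k)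
    (w : W) :
    ∃ φ', IsEdgeColoring H k φ' ∧
      (∀ u v, H.Adj u v → (kempe H φ hφ.1 a b).Reachable w u →
        φ' u v = Equiv.swap a b (φ u v)) ∧
      (∀ u v, H.Adj u v → ¬ (kempe H φ hφ.1 a b).Reachable w u → φ' u v = φ u v) := by
  classical
  set K := kempe H φ hφ.1 a b with hK
  let φ' : W → W → ℕ := fun u v =>
    if K.Reachable w u ∧ K.Adj u v then Equiv.swap a b (φ u v) else φ u v
  have e1 : ∀ u v, H.Adj u v → K.Reachable w u → φ' u v = Equiv.swap a b (φ u v) := by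
    intro u v h r
    by_cases hk : K.Adj u v
    · simp only [φ', r, hk, and_self, if_true]
    · simp only [φ', hk, and_false, if_false]
      rw [Equiv.swap_apply_of_ne_of_ne]
      · exact fun h' => hk ⟨h, Or.inl h'⟩
      · exact fun h' => hk ⟨h, Or.inr h'⟩
  have e2 : ∀ u v, H.Adj u v → ¬ K.Reachable w u → φ' u v = φ u v := by
    intro u v _ r
    simp only [φ', r, false_and, if_false]
  refine ⟨φ', ⟨?_, ?_, ?_⟩, e1, e2⟩
  · intro u v
    by_cases hk : K.Adj u v
    · have : K.Reachable w u ↔ K.Reachable w v :=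
        ⟨fun h => h.trans hk.reachable, fun h => h.trans hk.symm.reachable⟩
      simp only [φ', hk, hk.symm, this, hφ.1 u v]
    · have hk' : ¬ K.Adj v u := fun h => hk h.symm
      simp only [φ', hk, hk', and_false, if_false, hφ.1 u v]
  · intro u v h
    have h0 := hφ.2.1 h
    by_cases r : K.Reachable w u
    · rw [e1 u v h r, Equiv.swap_apply_def]
      split_ifs <;> assumption
    · rw [e2 u v h r]; exact h0
  · intro v p r hp hr hne
    by_cases hv : K.Reachable w v
    · rw [e1 v p hp hv, e1 v r hr hv]
      exact fun h => hφ.2.2 hp hr hne ((Equiv.swap a b).injective h)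
    · rw [e2 v p hp hv, e2 v r hr hv]
      exact hφ.2.2 hp hr hne

open Classical in
/-- Recolor a single edge. -/
noncomputable def updc {W : Type*} (φ : W → W → ℕ) (y w : W) (c : ℕ) : W → W → ℕ :=
  fun a b => if s(a, b) = s(y, w) then c else φ a b

lemma updc_same {W : Type*} (φ : W → W → ℕ) (y w : W) (c : ℕ) : updc φ y w c y w = c := by
  simp [updc]

lemma updc_ne {W : Type*} (φ : W → W → ℕ) (y w : W) (c : ℕ) {a b : W}
    (h : s(a, b) ≠ s(y, w)) : updc φ y w c a b = φ a b := by
  simp only [updc, if_neg h]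

lemma updc_col {W : Type*} {H0 H1 : SimpleGraph W} {k : ℕ} {φ : W → W → ℕ} {y w : W} {c : ℕ}
    (hφ : IsEdgeColoring H0 k φ) (hc : c ∈ Finset.Icc 1 k)
    (hH : ∀ a b, H1.Adj a b → s(a, b) ≠ s(y, w) → H0.Adj a b)
    (hy : ∀ b, H1.Adj y b → b ≠ w → φ y b ≠ c)
    (hw : ∀ b, H1.Adj w b → b ≠ y → φ w b ≠ c) : IsEdgeColoring H1 k (updc φ y w c) := by
  classical
  have key : ∀ v p r, H1.Adj v p → H1.Adj v r → p ≠ r → s(v, p) = s(y, w) → φ v r ≠ c := by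
    intro v p r _ hr hne h
    rw [Sym2.eq_iff] at h
    rcases h with ⟨rfl, rfl⟩ | ⟨rfl, rfl⟩
    · exact hy r hr hne.symm
    · exact hw r hr hne.symm
  refine ⟨?_, ?_, ?_⟩
  · intro u v
    simp only [updc]
    rw [Sym2.eq_swap (a := u) (b := v), hφ.1 u v]
  · intro u v h
    by_cases h' : s(u, v) = s(y, w)
    · simpa only [updc, if_pos h'] using hc
    · rw [updc_ne _ _ _ _ h']; exact hφ.2.1 (hH _ _ h h')
  · intro v p r hp hr hne
    by_cases h1 : s(v, p) = s(y, w) <;> by_cases h2 : s(v, r) = s(y, w)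
    · exact absurd (Sym2.congr_right.1 (h1.trans h2.symm)) hne
    · simp only [updc, if_pos h1, if_neg h2]
      exact (key v p r hp hr hne h1).symm
    · simp only [updc, if_neg h1, if_pos h2]
      exact key v r p hr hp hne.symm h2
    · simp only [updc, if_neg h1, if_neg h2]
      exact hφ.2.2 (hH _ _ hp h1) (hH _ _ hr h2) hne

/-- The missing colors of `x` and `y` are disjoint. -/
lemma disj {W : Type*} {G : SimpleGraph W} {k : ℕ} {x y : W} {φ : W → W → ℕ}
    (hno : ¬ ∃ ψ, IsEdgeColoring G k ψ) (hφ : IsEdgeColoring (del G x y) k φ) {c : ℕ}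
    (hc : c ∈ Finset.Icc 1 k) (hx : Miss (del G x y) φ x c) (hy : Miss (del G x y) φ y c) :
    False := by
  refine hno ⟨updc φ x y c, updc_col hφ hc (fun a b h h' => del_adj.2 ⟨h, h'⟩) ?_ ?_⟩
  · intro b hb hne
    refine hx b (del_adj.2 ⟨hb, ?_⟩)
    intro h
    exact hne (Sym2.congr_right.1 h)
  · intro b hb hne
    refine hy b (del_adj.2 ⟨hb, ?_⟩)
    intro h
    rw [Sym2.eq_swap (a := x)] at h
    exact hne (Sym2.congr_right.1 h)

lemma kswap {W : Type*} [Fintype W] {G : SimpleGraph W} {k : ℕ} {x y w : W} {φ : W → W → ℕ}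
    (hno : ¬ ∃ ψ, IsEdgeColoring G k ψ) (hxy : G.Adj x y)
    (hφ : IsEdgeColoring (del G x y) k φ) {a b : ℕ}
    (ha : a ∈ Finset.Icc 1 k) (hb : b ∈ Finset.Icc 1 k)
    (hxa : Miss (del G x y) φ x a) (hyb : Miss (del G x y) φ y b)
    (hwa : Miss (del G x y) φ w a) (hwx : w ≠ x) (hwy : w ≠ y) :
    ∃ φ', IsEdgeColoring (del G x y) k φ' ∧ (∀ v, (del G x y).Adj x v → φ' x v = φ x v) ∧
      (∀ v, (del G x y).Adj y v → φ' y v = φ y v) ∧ Miss (del G x y) φ' w b ∧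
      (∀ u v, (del G x y).Adj u v → ∀ c, c ≠ a → c ≠ b → (φ' u v = c ↔ φ u v = c)) ∧
      (∀ v, (del G x y).Adj w v → φ w v = b → φ' w v = a) := by
  set H := del G x y with hH
  -- x and y are linked
  have link : (kempe H φ hφ.1 a b).Reachable x y := by
    by_contra hn
    obtain ⟨φ', h1, h2, h3⟩ := kempe_change H k φ hφ a b ha hb x
    refine disj hno h1 hb ?_ ?_
    · intro u hu
      rw [h2 x u hu (SimpleGraph.Reachable.refl _)]
      intro h
      apply hxa u hu
      exact (Equiv.swap a b).injective (h.trans (by simp))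
    · intro u hu
      rw [h3 y u hu hn]
      exact hyb u hu
  have nr : ∀ v, v = x ∨ v = y → ¬ (kempe H φ hφ.1 a b).Reachable w v := by
    intro v hv r
    have rx : (kempe H φ hφ.1 a b).Reachable w x := by
      rcases hv with rfl | rfl
      · exact r
      · exact r.trans link.symm
    exact kempe_three H k φ hφ a b x y w hxy.ne hwx.symm hwy.symm (Or.inl hxa) (Or.inr hyb)
      (Or.inl hwa) rx (rx.trans link)
  obtain ⟨φ', h1, h2, h3⟩ := kempe_change H k φ hφ a b ha hb w
  refine ⟨φ', h1, fun v hv => h3 x v hv (nr x (Or.inl rfl)),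
    fun v hv => h3 y v hv (nr y (Or.inr rfl)), ?_, ?_, ?_⟩
  · intro u hu h
    rw [h2 w u hu (SimpleGraph.Reachable.refl _)] at h
    apply hwa u hu
    exact (Equiv.swap a b).injective (h.trans (by simp))
  · intro u v h c hca hcb
    by_cases r : (kempe H φ hφ.1 a b).Reachable w u
    · rw [h2 u v h r, Equiv.swap_apply_def]
      split_ifs with h4 h5
      · subst h4; constructor
        · intro h; exact absurd h.symm hcb
        · intro h; exact absurd h.symm hca
      · subst h5; constructor
        · intro h; exact absurd h.symm hca
        · intro h; exact absurd h.symm hcb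
      · rfl
    · rw [h3 u v h r]
  · intro v hv h
    rw [h2 w v hv (SimpleGraph.Reachable.refl _), h, Equiv.swap_apply_right]

lemma exists_miss {W : Type*} [Fintype W] {G : SimpleGraph W} [DecidableRel G.Adj]
    {x y : W} {φ : W → W → ℕ} (hxy : G.Adj x y) :
    ∃ c ∈ Finset.Icc 1 G.maxDegree, Miss (del G x y) φ y c := by
  classical
  have hcard : (((G.neighborFinset y).erase x).image (φ y)).card
      < (Finset.Icc 1 G.maxDegree).card := by
    refine Finset.card_image_le.trans_lt ?_
    rw [Finset.card_erase_of_mem (by simpa using hxy.symm), SimpleGraph.card_neighborFinset_eq_degree]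
    have h1 := G.degree_le_maxDegree y
    have h2 : 0 < G.degree y := (G.degree_pos_iff_exists_adj y).2 ⟨x, hxy.symm⟩
    simp; omega
  obtain ⟨c, hc, hn⟩ := Finset.exists_mem_notMem_of_card_lt_card hcard
  refine ⟨c, hc, fun u hu h => hn ?_⟩
  rw [del_adj] at hu
  refine Finset.mem_image.2 ⟨u, Finset.mem_erase.2 ⟨?_, by simpa using hu.1⟩, h⟩
  rintro rfl
  exact hu.2 Sym2.eq_swap

lemma exists_common {W : Type*} [Fintype W] {G : SimpleGraph W} [DecidableRel G.Adj]
    {x y w : W} {φ : W → W → ℕ} (hxy : G.Adj x y)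
    (hd : G.degree x + G.degree w < G.maxDegree) (f : ℕ) :
    ∃ c ∈ Finset.Icc 1 G.maxDegree, c ≠ f ∧ Miss (del G x y) φ x c ∧ Miss (del G x y) φ w c := by
  classical
  set S := insert f ((((G.neighborFinset x).erase y).image (φ x)) ∪
    ((G.neighborFinset w).image (φ w))) with hS
  have hcard : S.card < (Finset.Icc 1 G.maxDegree).card := by
    have h0 : (((G.neighborFinset x).erase y).image (φ x)).card ≤ G.degree x - 1 := by
      refine Finset.card_image_le.trans ?_
      rw [Finset.card_erase_of_mem (by simpa using hxy), SimpleGraph.card_neighborFinset_eq_degree]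
    have h1 : ((G.neighborFinset w).image (φ w)).card ≤ G.degree w := by
      refine Finset.card_image_le.trans ?_
      rw [SimpleGraph.card_neighborFinset_eq_degree]
    have h2 : 0 < G.degree x := (G.degree_pos_iff_exists_adj x).2 ⟨y, hxy⟩
    have h3 := Finset.card_insert_le f ((((G.neighborFinset x).erase y).image (φ x)) ∪
      ((G.neighborFinset w).image (φ w)))
    have h4 := Finset.card_union_le (((G.neighborFinset x).erase y).image (φ x))
      ((G.neighborFinset w).image (φ w))
    rw [Nat.card_Icc, hS]
    omega
  obtain ⟨c, hc, hn⟩ := Finset.exists_mem_notMem_of_card_lt_card hcard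
  simp only [hS, Finset.mem_insert, Finset.mem_union, not_or] at hn
  refine ⟨c, hc, hn.1, fun u hu h => hn.2.1 ?_, fun u hu h => hn.2.2 ?_⟩
  · rw [del_adj] at hu
    refine Finset.mem_image.2 ⟨u, Finset.mem_erase.2 ⟨?_, by simpa using hu.1⟩, h⟩
    rintro rfl
    exact hu.2 rfl
  · rw [del_adj] at hu
    exact Finset.mem_image.2 ⟨u, by simpa using hu.1, h⟩

/-- Free the color of the edge `yw`, with `w` of low degree, at `y`. -/
lemma free_color {W : Type*} [Fintype W] {G : SimpleGraph W} [DecidableRel G.Adj]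
    {x y w : W} {φ : W → W → ℕ}
    (hno : ¬ ∃ ψ, IsEdgeColoring G G.maxDegree ψ) (hxy : G.Adj x y)
    (hφ : IsEdgeColoring (del G x y) G.maxDegree φ) (hyw : (del G x y).Adj y w)
    (hd : G.degree x + G.degree w < G.maxDegree) (f : ℕ) :
    ∃ φ', IsEdgeColoring (del G x y) G.maxDegree φ' ∧
      (∀ v, (del G x y).Adj x v → φ' x v = φ x v) ∧
      (∀ v, (del G x y).Adj y v → v ≠ w → φ' y v = φ y v) ∧
      Miss (del G x y) φ' y (φ y w) ∧
      (∀ a b, (del G x y).Adj a b → s(a, b) ≠ s(y, w) → ∀ c, ¬ Miss (del G x y) φ y c →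
        (¬ Miss (del G x y) φ x c ∨ c = f) → (φ' a b = c ↔ φ a b = c)) := by
  have hwx : w ≠ x := by
    rintro rfl
    exact (del_adj.1 hyw).2 Sym2.eq_swap
  have hwy : w ≠ y := hyw.ne'
  obtain ⟨η, hη, hηf, hηx, hηw⟩ := exists_common (φ := φ) hxy hd f
  obtain ⟨δ, hδ, hδy⟩ := exists_miss (φ := φ) hxy
  obtain ⟨φ1, c1, ex, ey, mw, ec, -⟩ := kswap hno hxy hφ hη hδ hηx hδy hηw hwx hwy
  have hx' : ∀ v, s(x, v) ≠ s(y, w) := by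
    intro v h
    rw [Sym2.eq_iff] at h
    rcases h with ⟨h, -⟩ | ⟨h, -⟩
    · exact hxy.ne h
    · exact hwx h.symm
  refine ⟨updc φ1 y w δ, updc_col c1 hδ (fun a b h _ => h) ?_ ?_, ?_, ?_, ?_, ?_⟩
  · intro b hb _
    rw [ey b hb]; exact hδy b hb
  · intro b hb _
    exact mw b hb
  · intro v hv
    rw [updc_ne _ _ _ _ (hx' v), ex v hv]
  · intro v hv hne
    rw [updc_ne _ _ _ _ (fun h => hne (Sym2.congr_right.1 h)), ey v hv]
  · intro v hv
    by_cases hne : v = w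
    · subst hne
      rw [updc_same]
      exact (hδy v hv).symm
    · rw [updc_ne _ _ _ _ (fun h => hne (Sym2.congr_right.1 h)), ey v hv]
      exact hφ.2.2 hv hyw hne
  · intro a b hab hne c hc hc'
    rw [updc_ne _ _ _ _ hne]
    refine ec a b hab c ?_ ?_
    · rintro rfl
      rcases hc' with h | h
      · exact h hηx
      · exact hηf h
    · rintro rfl
      exact hc hδy

/-- Move the uncolored edge from `xy` to `xz`. -/
lemma shift {W : Type*} {G : SimpleGraph W} {k : ℕ} {x y z : W} {φ : W → W → ℕ}
    (hφ : IsEdgeColoring (del G x y) k φ) (hz : (del G x y).Adj x z)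
    (hm : Miss (del G x y) φ y (φ x z)) :
    IsEdgeColoring (del G x z) k (updc φ x y (φ x z)) := by
  refine updc_col hφ (hφ.2.1 hz) ?_ ?_ ?_
  · intro a b h h'
    exact del_adj.2 ⟨(del_adj.1 h).1, h'⟩
  · intro b hb hne
    rw [del_adj] at hb
    refine hφ.2.2 (del_adj.2 ⟨hb.1, fun h => hne (Sym2.congr_right.1 h)⟩) hz ?_
    rintro rfl
    exact hb.2 rfl
  · intro b hb hne
    rw [del_adj] at hb
    refine hm b (del_adj.2 ⟨hb.1, fun h => hne ?_⟩)
    rw [Sym2.eq_swap (a := x)] at h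
    exact Sym2.congr_right.1 h

/-- The part of the configuration that does not depend on the coloring. -/
structure Base {W : Type*} [Fintype W] (G : SimpleGraph W) [DecidableRel G.Adj] (L : W → Prop)
    (x z' u : W) : Prop where
  hno : ¬ ∃ ψ, IsEdgeColoring G G.maxDegree ψ
  low : ∀ w, L w → G.degree x + G.degree w < G.maxDegree
  nb : ∀ v, G.Adj x v → ¬ L v
  adj : G.Adj x z'
  adju : G.Adj z' u
  ux : u ≠ x
  Lu : L u

lemma sym_ne {W : Type*} {a b c d : W} (h1 : a ≠ c) (h2 : a ≠ d) : s(a, b) ≠ s(c, d) := by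
  intro h
  rw [Sym2.eq_iff] at h
  rcases h with ⟨h, -⟩ | ⟨h, -⟩
  · exact h1 h
  · exact h2 h

section
variable {W : Type*} [Fintype W] {G : SimpleGraph W} [DecidableRel G.Adj] {L : W → Prop}
  {x y z z' u : W} {φ : W → W → ℕ}

lemma Base.adjH (h : Base G L x z' u) (y : W) (hy : z' ≠ y) : (del G x y).Adj z' u :=
  del_adj.2 ⟨h.adju, sym_ne h.adj.ne' hy⟩

lemma Base.adjX (h : Base G L x z' u) (y : W) (hy : z' ≠ y) : (del G x y).Adj x z' :=
  del_adj.2 ⟨h.adj, fun h => hy (Sym2.congr_right.1 h)⟩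

lemma fin4 (h : Base G L x z' u) (hz' : z' ≠ z)
    (hφ : IsEdgeColoring (del G x z) G.maxDegree φ)
    (hm : Miss (del G x z) φ z (φ x z')) (hf : Miss (del G x z) φ x (φ z' u)) : False := by
  have hx := h.adjX z hz'
  have hψ := shift hφ hx hm
  set ψ := updc φ x z (φ x z') with hψd
  have hu : (del G x z').Adj z' u :=
    del_adj.2 ⟨h.adju, by rw [Sym2.eq_swap (a := x)]; exact fun h' => h.ux (Sym2.congr_right.1 h')⟩
  have e : ψ z' u = φ z' u := updc_ne _ _ _ _ (sym_ne h.adj.ne' hz')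
  obtain ⟨φ', c', ex, -, m, -⟩ := free_color h.hno h.adj hψ hu (h.low u h.Lu) 0
  refine disj h.hno c' (hψ.2.1 hu) ?_ m
  intro v hv
  rw [ex v hv, e]
  by_cases hvz : v = z
  · subst hvz
    rw [hψd, updc_same]
    exact hf z' hx
  · rw [hψd, updc_ne _ _ _ _ (fun h' => hvz (Sym2.congr_right.1 h'))]
    exact hf v (del_adj.2 ⟨(del_adj.1 hv).1, fun h' => hvz (Sym2.congr_right.1 h')⟩)

lemma fin3 (h : Base G L x z' u) (hz : G.Adj x z) (hz' : z' ≠ z)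
    (hφ : IsEdgeColoring (del G x z) G.maxDegree φ)
    (hQ : ∀ v, (del G x z).Adj z v → φ z v = φ x z' → L v)
    (hf : Miss (del G x z) φ x (φ z' u)) : False := by
  by_cases hm : Miss (del G x z) φ z (φ x z')
  · exact fin4 h hz' hφ hm hf
  · simp only [Miss, not_forall, not_not] at hm
    obtain ⟨v, hv, hβ⟩ := hm
    have Lv := hQ v hv hβ
    have hu := h.adjH z hz'
    obtain ⟨φ', c', ex, -, m, ec⟩ := free_color h.hno hz hφ hv (h.low v Lv) (φ z' u)
    have e : φ' z' u = φ z' u := by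
      refine (ec z' u hu (sym_ne hz' ?_) _ ?_ (Or.inr rfl)).2 rfl
      · rintro rfl; exact h.nb _ h.adj Lv
      · intro hm; exact disj h.hno hφ (hφ.2.1 hu) hf hm
    refine fin4 h hz' c' ?_ ?_
    · rw [ex z' (h.adjX z hz'), ← hβ]; exact m
    · rw [e]; intro b hb; rw [ex b hb]; exact hf b hb

lemma fin2a (h : Base G L x z' u) (hz : (del G x y).Adj x z) (hzz : z' ≠ z) (hzy : z' ≠ y)
    (hφ : IsEdgeColoring (del G x y) G.maxDegree φ)
    (hm : Miss (del G x y) φ y (φ x z))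
    (hQ : ∀ v, (del G x y).Adj z v → φ z v = φ x z' → L v)
    (hf : Miss (del G x y) φ x (φ z' u)) : False := by
  have hψ := shift hφ hz hm
  have hz0 := del_adj.1 hz
  have hzy' : z ≠ y := by rintro rfl; exact hz0.2 rfl
  set ψ := updc φ x y (φ x z) with hψd
  have e1 : ψ x z' = φ x z' := updc_ne _ _ _ _ (fun h' => hzy (Sym2.congr_right.1 h'))
  have e2 : ψ z' u = φ z' u := updc_ne _ _ _ _ (sym_ne h.adj.ne' hzy)
  refine fin3 (φ := ψ) h hz0.1 hzz hψ ?_ ?_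
  · intro v hv
    have hne : s(z, v) ≠ s(x, y) := sym_ne hz0.1.ne' hzy'
    rw [e1, hψd, updc_ne _ _ _ _ hne]
    exact hQ v (del_adj.2 ⟨(del_adj.1 hv).1, hne⟩)
  · rw [e2]
    intro v hv
    by_cases hvy : v = y
    · subst hvy
      rw [hψd, updc_same]
      exact hf z hz
    · have hne : s(x, v) ≠ s(x, y) := fun h' => hvy (Sym2.congr_right.1 h')
      rw [hψd, updc_ne _ _ _ _ hne]
      exact hf v (del_adj.2 ⟨(del_adj.1 hv).1, hne⟩)

/-- The configuration with the coloring `φ` of `G - xy`. -/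
structure Cfg {W : Type*} [Fintype W] (G : SimpleGraph W) [DecidableRel G.Adj] (L : W → Prop)
    (x y z z' u : W) (φ : W → W → ℕ) : Prop extends Base G L x z' u where
  hxy : G.Adj x y
  hz : (del G x y).Adj x z
  hzz : z' ≠ z
  hzy : z' ≠ y
  hφ : IsEdgeColoring (del G x y) G.maxDegree φ
  hP : ∀ v, (del G x y).Adj y v → φ y v = φ x z → L v
  hQ : ∀ v, (del G x y).Adj z v → φ z v = φ x z' → L v
  hy : ¬ Miss (del G x y) φ y (φ x z')

lemma Cfg.zy (h : Cfg G L x y z z' u φ) : z ≠ y := by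
  rintro rfl; exact (del_adj.1 h.hz).2 rfl

/-- `free_color` preserves the configuration. -/
lemma Cfg.free (h : Cfg G L x y z z' u φ) {w : W} (hw : (del G x y).Adj y w) (Lw : L w)
    (hne : φ y w ≠ φ x z') (f : ℕ) :
    ∃ φ', Cfg G L x y z z' u φ' ∧ (∀ v, (del G x y).Adj x v → φ' x v = φ x v) ∧
      Miss (del G x y) φ' y (φ y w) ∧
      (¬ Miss (del G x y) φ y (φ z' u) →
        (¬ Miss (del G x y) φ x (φ z' u) ∨ φ z' u = f) → φ' z' u = φ z' u) := by
  have hx := h.toBase.adjX y h.hzy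
  obtain ⟨φ', c', ex, ey, m, ec⟩ := free_color h.hno h.hxy h.hφ hw (h.low w Lw) f
  have nw : ∀ v, G.Adj x v → v ≠ w := by
    rintro v hv rfl
    exact h.nb _ hv Lw
  refine ⟨φ', ⟨h.toBase, h.hxy, h.hz, h.hzz, h.hzy, c', ?_, ?_, ?_⟩, ex, m, ?_⟩
  · intro v hv
    by_cases hvw : v = w
    · subst hvw; exact fun _ => Lw
    · rw [ey v hv hvw, ex z h.hz]; exact h.hP v hv
  · intro v hv he
    rw [ex z' hx] at he
    refine h.hQ v hv ((ec z v hv (sym_ne h.zy (nw z (del_adj.1 h.hz).1)) _ h.hy (Or.inl ?_)).1 he)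
    exact fun hm => hm z' hx rfl
  · rw [ex z' hx]
    intro hm
    refine h.hy fun v hv he => ?_
    have hvw : v ≠ w := by rintro rfl; exact hne he
    exact hm v hv ((ey v hv hvw).trans he)
  · intro h1 h2
    exact (ec z' u (h.toBase.adjH y h.hzy) (sym_ne h.hzy (nw z' h.adj)) _ h1 h2).2 rfl

lemma fin2 (h : Cfg G L x y z z' u φ) (hf : Miss (del G x y) φ x (φ z' u)) : False := by
  by_cases hm : Miss (del G x y) φ y (φ x z)
  · exact fin2a h.toBase h.hz h.hzz h.hzy h.hφ hm h.hQ hf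
  · simp only [Miss, not_forall, not_not] at hm
    obtain ⟨w, hw, hα⟩ := hm
    have hu := h.toBase.adjH y h.hzy
    obtain ⟨φ', h', ex, m, e⟩ := h.free hw (h.hP w hw hα)
      (by rw [hα]; exact h.hφ.2.2 h.hz (h.toBase.adjX y h.hzy) h.hzz.symm) (φ z' u)
    have e := e (fun hm => disj h.hno h.hφ (h.hφ.2.1 hu) hf hm) (Or.inr rfl)
    refine fin2a h'.toBase h'.hz h'.hzz h'.hzy h'.hφ ?_ h'.hQ ?_
    · rw [ex z h.hz, ← hα]; exact m
    · rw [e]; intro v hv; rw [ex v hv]; exact hf v hv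

lemma fin1b (h : Cfg G L x y z z' u φ) (hf : Miss (del G x y) φ y (φ z' u)) : False := by
  have hu := h.toBase.adjH y h.hzy
  have hx := h.toBase.adjX y h.hzy
  obtain ⟨η, hη, -, hηx, hηu⟩ := exists_common (φ := φ) h.hxy (h.low u h.Lu) 0
  have huy : u ≠ y := by rintro rfl; exact h.nb _ h.hxy h.Lu
  obtain ⟨φ', c', ex, ey, -, ec, eu⟩ :=
    kswap h.hno h.hxy h.hφ hη (h.hφ.2.1 hu) hηx hf hηu h.ux huy
  have e : φ' z' u = η := by
    rw [c'.1]; exact eu z' hu.symm (h.hφ.1 _ _)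
  refine fin2 (φ := φ') ⟨h.toBase, h.hxy, h.hz, h.hzz, h.hzy, c', ?_, ?_, ?_⟩ ?_
  · intro v hv
    rw [ey v hv, ex z h.hz]; exact h.hP v hv
  · intro v hv he
    rw [ex z' hx] at he
    refine h.hQ v hv ((ec z v hv _ (hηx z' hx) ?_).1 he)
    rw [h.hφ.1 x z']
    exact h.hφ.2.2 hx.symm hu h.ux.symm
  · rw [ex z' hx]
    exact fun hm => h.hy fun v hv => by rw [← ey v hv]; exact hm v hv
  · rw [e]; intro v hv; rw [ex v hv]; exact hηx v hv

lemma fin1 (h : Cfg G L x y z z' u φ)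
    (hτ : Miss (del G x y) φ x (φ z' u) ∨ ∀ v, (del G x y).Adj y v → φ y v = φ z' u → L v) :
    False := by
  by_cases h1 : Miss (del G x y) φ x (φ z' u)
  · exact fin2 h h1
  by_cases h2 : Miss (del G x y) φ y (φ z' u)
  · exact fin1b h h2
  have h2' := h2
  simp only [Miss, not_forall, not_not] at h2'
  obtain ⟨w, hw, he⟩ := h2'
  have hu := h.toBase.adjH y h.hzy
  have hx := h.toBase.adjX y h.hzy
  obtain ⟨φ', h', ex, m, e⟩ := h.free hw (hτ.resolve_left h1 w hw he)
    (by rw [he, h.hφ.1 x z']; exact h.hφ.2.2 hu hx.symm h.ux) 0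
  have e := e h2 (Or.inl h1)
  refine fin1b h' ?_
  rw [e, ← he]; exact m

end

/-- Let `G` be a `Δ`-critical simple graph, `ε ∈ (0,1)`, `q = (1-ε)Δ`, `xy ∈ E(G)` with
`d(x) < εΔ`, and `φ ∈ C^Δ(G - xy)`. If `|B_φ(x,y,q)| = 1` and there exists
`z ∈ N(x, M_φ)` with `φ_b(z) ∩ B_φ(x,y,q) ≠ ∅`, then for every `z' ∈ N(x, B_φ)` and every
`u ∈ N(z') - {x}`, one has `d(u) ≥ q`. -/
theorem statement9 (G : SimpleGraph V) [DecidableRel G.Adj] (hG : IsDeltaCritical G)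
    (ε : ℝ) (hε : ε ∈ Set.Ioo (0 : ℝ) 1) (q : ℝ) (hq : q = (1 - ε) * G.maxDegree)
    (x y : V) (hxy : G.Adj x y) (hx : (G.degree x : ℝ) < ε * G.maxDegree)
    (H : SimpleGraph V) (hH : H = G.deleteEdges {s(x, y)})
    (φ : V → V → ℕ) (hφ : IsEdgeColoring H G.maxDegree φ)
    (hB : (Bset G H φ q x y).ncard = 1)
    (hz : ∃ z ∈ NxM G H G.maxDegree φ q x y,
      (phib G H G.maxDegree φ q z ∩ Bset G H φ q x y).Nonempty) :
    ∀ z' ∈ NxB G H φ q x y, ∀ u : V, G.Adj z' u → u ≠ x → q ≤ (G.degree u : ℝ) := by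
  intro z' hz' u hu hux
  by_contra hLu
  rw [not_le] at hLu
  change H = del G x y at hH
  subst hH
  obtain ⟨-, hχ, hcrit⟩ := hG
  have hno : ¬ ∃ ψ, IsEdgeColoring G G.maxDegree ψ := by
    intro hex
    have : chromIndex G ≤ G.maxDegree := Nat.sInf_le hex
    omega
  have low : ∀ w, (G.degree w : ℝ) < q → G.degree x + G.degree w < G.maxDegree := by
    intro w hw
    have : (G.degree x : ℝ) + G.degree w < G.maxDegree := by rw [hq] at hw; linarith
    exact_mod_cast this
  have nb : ∀ v, G.Adj x v → ¬ (G.degree v : ℝ) < q := by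
    intro v hv hL
    have hl := low v hL
    have h1 := hcrit s(x, v) hv
    have hne : {k | ∃ φ : V → V → ℕ, IsEdgeColoring (del G x v) k φ}.Nonempty := by
      apply Nat.nonempty_of_pos_sInf
      change 0 < chromIndex (G.deleteEdges {s(x, v)})
      omega
    have h2 := Nat.sInf_mem hne
    change ∃ φ : V → V → ℕ, IsEdgeColoring (del G x v) (chromIndex (G.deleteEdges {s(x, v)})) φ
      at h2
    rw [h1] at h2
    obtain ⟨ψ, hψ⟩ := h2
    obtain ⟨c, hc, -, m1, m2⟩ := exists_common (φ := ψ) hv hl 0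
    exact disj hno hψ hc m1 m2
  obtain ⟨β, hβ⟩ := Set.ncard_eq_one.1 hB
  obtain ⟨z, ⟨hxz, hzM⟩, β', hb1, hb2⟩ := hz
  obtain ⟨hxz', hz'B⟩ := hz'
  have hβz : φ x z' = β := by rw [hβ] at hz'B; exact hz'B
  have hβ' : β' = β := by rw [hβ] at hb2; exact hb2
  subst hβ'
  have hP : ∀ v, (del G x y).Adj y v → φ y v = φ x z → (G.degree v : ℝ) < q := by
    intro v hv he
    rcases hzM with (⟨-, w, hw, hwe, hwq⟩ | hm) | hm
    · have : v = w := by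
        by_contra hne
        exact hφ.2.2 hv hw hne (he.trans hwe.symm)
      rwa [this]
    · exact absurd ⟨z, hxz, rfl⟩ hm.2
    · exact absurd ⟨v, hv, he⟩ hm.2
  have hzy : z' ≠ y := by
    rintro rfl
    exact (del_adj.1 hxz').2 rfl
  obtain ⟨-, u0, hu0, hu0e, hu0q⟩ := hz'B
  have hcfg : Cfg G (fun w => (G.degree w : ℝ) < q) x y z z' u φ := by
    refine ⟨⟨hno, low, nb, (del_adj.1 hxz').1, hu, hux, hLu⟩, hxy, hxz, ?_, hzy, hφ, hP, ?_, ?_⟩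
    · rintro rfl
      exact absurd (hP u0 hu0 hu0e) (not_lt.2 hu0q)
    · intro v hv he
      rw [hβz] at he
      rcases hb1.2 with hn | ⟨w, hw, hwe, hwq⟩
      · exact absurd ⟨v, hv, he⟩ hn
      · have : v = w := by
          by_contra hne
          exact hφ.2.2 hv hw hne (he.trans hwe.symm)
        subst this; exact hwq
    · exact fun hm => hm u0 hu0 hu0e
  refine fin1 hcfg ?_
  by_cases h1 : Miss (del G x y) φ x (φ z' u)
  · exact Or.inl h1
  · right
    intro v hv he
    by_contra hge
    have h1' := h1
    simp only [Miss, not_forall, not_not] at h1'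
    obtain ⟨t, ht, hte⟩ := h1'
    have hmem : φ z' u ∈ Bset G (del G x y) φ q x y := ⟨⟨t, ht, hte⟩, v, hv, he, not_lt.1 hge⟩
    rw [hβ] at hmem
    have hmem : φ z' u = β' := hmem
    have := hφ.2.2 (hcfg.toBase.adjH y hzy) (hxz'.symm) hux
    exact this (by rw [hmem, ← hβz, hφ.1])
end

section
/- Let G be a Δ-critical simple graph, ε ∈ (0,1), q = (1−ε)Δ, and let xy ∈ E(G) with d(x) < εΔ and φ ∈ C^Δ(G−xy). Suppose z ∈ N(x, M_φ), β ∈ φ_b(z) ∩ B_φ(x,y,q), and w ∈ N(x, B_φ) with φ(xw) = β. Define B_w(φ) = {φ(ww') : w' ∈ N(w), φ(ww') ∈ B_φ(x,y,q)−{β}, and d(w') < q}. Then for every β' ∈ B_w(φ) there exist z' ∈ N(x, B_φ) and u ∈ N(z') such that φ(xz') = β', φ(z'u) = β, and d(u) ≥ q. -/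
open Finset

variable {V : Type*}

variable [Fintype V]

/-- Two paths leaving `s` away from `r` and ending in vertices of degree at most one agree. -/
theorem path_end_unique {V : Type*} (K : SimpleGraph V)
    (h2 : ∀ a b c d, K.Adj a b → K.Adj a c → K.Adj a d → b = c ∨ b = d ∨ c = d)
    {s w : V} (p : K.Walk s w) : p.IsPath → ∀ {w' : V} (p' : K.Walk s w'), p'.IsPath →
    ∀ r, K.Adj s r → r ∉ p.support → r ∉ p'.support →
    (∀ a b, K.Adj w a → K.Adj w b → a = b) → (∀ a b, K.Adj w' a → K.Adj w' b → a = b) →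
    w = w' := by
  induction p with
  | nil =>
    intro _ w' p' hp' r hr h1 h1' hw hw'
    cases p' with
    | nil => rfl
    | cons h t =>
      exfalso
      have := hw _ _ hr h
      subst this
      simp at h1'
  | @cons s t w h p ih =>
    intro hp w' p' hp' r hr h1 h1' hw hw'
    cases p' with
    | nil =>
      exfalso
      have := hw' _ _ hr h
      subst this
      simp at h1
    | @cons _ t' _ h' p' =>
      rw [SimpleGraph.Walk.cons_isPath_iff] at hp hp'
      rw [SimpleGraph.Walk.support_cons, List.mem_cons] at h1 h1'
      push Not at h1 h1'
      have htt : t = t' := by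
        rcases h2 s r t t' hr h h' with e | e | e
        · subst e; exact absurd (SimpleGraph.Walk.start_mem_support _) h1.2
        · subst e; exact absurd (SimpleGraph.Walk.start_mem_support _) h1'.2
        · exact e
      subst htt
      exact ih hp.1 p' hp'.1 s h.symm hp.2 hp'.2 hw hw'

theorem reach_end_unique {V : Type*} (K : SimpleGraph V)
    (h2 : ∀ a b c d, K.Adj a b → K.Adj a c → K.Adj a d → b = c ∨ b = d ∨ c = d)
    {x w t : V} (hxw : x ≠ w) (hxt : x ≠ t)
    (hx : ∀ a b, K.Adj x a → K.Adj x b → a = b)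
    (hw : ∀ a b, K.Adj w a → K.Adj w b → a = b)
    (ht : ∀ a b, K.Adj t a → K.Adj t b → a = b)
    (rw1 : K.Reachable x w) (rt : K.Reachable x t) : w = t := by
  classical
  obtain ⟨p, hp⟩ := rw1.exists_isPath
  obtain ⟨p', hp'⟩ := rt.exists_isPath
  cases p with
  | nil => exact absurd rfl hxw
  | cons h p =>
    cases p' with
    | nil => exact absurd rfl hxt
    | cons h' p' =>
      have := hx _ _ h h'
      subst this
      rw [SimpleGraph.Walk.cons_isPath_iff] at hp hp'
      exact path_end_unique K h2 p hp.1 p' hp'.1 x h.symm hp.2 hp'.2 hw ht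

/-- `c` colors every edge of `G` but `xw`, with colors in `[1,D]`; color `0` means no color. -/
structure PC {V : Type*} (G : SimpleGraph V) (D : ℕ) (x w : V) (c : V → V → ℕ) : Prop where
  symm : ∀ u v, c u v = c v u
  le : ∀ u v, c u v ≤ D
  adj : ∀ u v, c u v ≠ 0 → G.Adj u v
  inj : ∀ v a b, c v a = c v b → c v a ≠ 0 → a = b
  zero : c x w = 0
  nz : ∀ u v, G.Adj u v → c u v = 0 → (u = x ∧ v = w) ∨ (u = w ∧ v = x)
  hxw : G.Adj x w

/-- Color `k` is missing at `v`. -/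
def Mis {V : Type*} (D : ℕ) (c : V → V → ℕ) (v : V) (k : ℕ) : Prop :=
  1 ≤ k ∧ k ≤ D ∧ ∀ u, c v u ≠ k

/-- There is no full coloring. -/
def NF {V : Type*} (G : SimpleGraph V) (D : ℕ) : Prop := ∀ c, ¬ IsEdgeColoring G D c

open Classical in
/-- Set the color of the edge `ab`. -/
noncomputable def setE {V : Type*} (c : V → V → ℕ) (a b : V) (k : ℕ) : V → V → ℕ :=
  fun u v => if (u = a ∧ v = b) ∨ (u = b ∧ v = a) then k else c u v

open Classical in
/-- Swap two colors on edges leaving `S`. -/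
noncomputable def sw {V : Type*} (c : V → V → ℕ) (a b : ℕ) (S : Set V) : V → V → ℕ :=
  fun u v => if u ∈ S then (if c u v = a then b else if c u v = b then a else c u v) else c u v

theorem pc_fill {V : Type*} {G : SimpleGraph V} {D : ℕ} {x w : V} {c : V → V → ℕ}
    (h : PC G D x w c) (hN : NF G D) {k : ℕ} (hx : Mis D c x k) (hw : Mis D c w k) : False := by
  apply hN (setE c x w k)
  obtain ⟨h1, h2, hx⟩ := hx
  obtain ⟨-, -, hw⟩ := hw
  have hs := h.symm
  refine ⟨?_, ?_, ?_⟩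
  · intro u v
    unfold setE
    rw [hs u v]
    congr 1
    apply propext
    tauto
  · intro u v huv
    unfold setE
    split_ifs with hh
    · simp [h1, h2]
    · have := h.nz u v huv
      have := h.le u v
      simp only [Finset.mem_Icc]
      constructor
      · by_contra hc
        exact hh (h.nz u v huv (by omega))
      · exact this
  · intro v a b ha hb hab
    unfold setE
    have hxw := h.hxw.ne
    split_ifs with h3 h4 h4
    · exfalso; apply hab
      grind
    · rcases h3 with ⟨rfl, rfl⟩ | ⟨rfl, rfl⟩
      · exact (hx b).symm
      · exact (hw b).symm
    · rcases h4 with ⟨rfl, rfl⟩ | ⟨rfl, rfl⟩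
      · exact (hx a)
      · exact (hw a)
    · intro he
      apply hab
      refine h.inj v a b he ?_
      intro h0
      exact h3 (h.nz v a ha h0)

theorem pc_swap {V : Type*} {G : SimpleGraph V} {D : ℕ} {x w : V} {c : V → V → ℕ}
    (h : PC G D x w c) {a b : ℕ} {S : Set V} (ha : 1 ≤ a ∧ a ≤ D) (hb : 1 ≤ b ∧ b ≤ D)
    (hS : ∀ u v, (c u v = a ∨ c u v = b) → u ∈ S → v ∈ S) : PC G D x w (sw c a b S) := by
  have h0 : ∀ u v, sw c a b S u v = 0 ↔ c u v = 0 := by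
    intro u v; unfold sw; split_ifs <;> omega
  refine ⟨?_, ?_, ?_, ?_, ?_, ?_, h.hxw⟩
  · intro u v
    have h1 := hS u v
    have h2 := hS v u
    rw [h.symm v u] at h2
    unfold sw
    rw [h.symm v u]
    by_cases hu : u ∈ S <;> by_cases hv : v ∈ S <;> simp only [hu, hv, if_true, if_false] <;>
      grind
  · intro u v
    have := h.le u v
    unfold sw; split_ifs <;> omega
  · intro u v huv
    exact h.adj u v (fun e => huv ((h0 u v).2 e))
  · intro v p r he hn
    have hn' : c v p ≠ 0 := fun e => hn ((h0 v p).2 e)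
    apply h.inj v p r _ hn'
    unfold sw at he
    split_ifs at he <;> omega
  · exact (h0 _ _).2 h.zero
  · intro u v huv e
    exact h.nz u v huv ((h0 _ _).1 e)

theorem pc_set {V : Type*} {G : SimpleGraph V} {D : ℕ} {x w : V} {c : V → V → ℕ}
    (h : PC G D x w c) {a b : V} {k : ℕ} (hab : c a b ≠ 0) (ha : Mis D c a k)
    (hb : Mis D c b k) : PC G D x w (setE c a b k) := by
  obtain ⟨h1, h2, ha⟩ := ha
  obtain ⟨-, -, hb⟩ := hb
  have hs := h.symm
  have hadj := h.adj a b hab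
  have hne := hadj.ne
  have h0 : ∀ u v, setE c a b k u v = 0 ↔ c u v = 0 := by
    intro u v; unfold setE
    have := hs a b
    split_ifs with hh
    · rcases hh with ⟨rfl, rfl⟩ | ⟨rfl, rfl⟩ <;> omega
    · rfl
  refine ⟨?_, ?_, ?_, ?_, ?_, ?_, h.hxw⟩
  · intro u v
    unfold setE
    rw [hs u v]
    congr 1
    apply propext
    tauto
  · intro u v
    have := h.le u v
    unfold setE; split_ifs <;> omega
  · intro u v huv
    exact h.adj u v (fun e => huv ((h0 u v).2 e))
  · intro v p r he hn
    have hn' : c v p ≠ 0 := fun e => hn ((h0 v p).2 e)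
    have := h.inj v p r
    unfold setE at he
    have ha1 := ha r
    have ha2 := ha p
    have hb1 := hb r
    have hb2 := hb p
    split_ifs at he <;> grind
  · exact (h0 _ _).2 h.zero
  · intro u v huv e
    exact h.nz u v huv ((h0 _ _).1 e)

/-- Move the uncolored edge from `xw` to `xv`. -/
theorem pc_shift {V : Type*} {G : SimpleGraph V} {D : ℕ} {x w v : V} {c : V → V → ℕ} {k : ℕ}
    (h : PC G D x w c) (hv : c x v = k) (hk : k ≠ 0) (hw : Mis D c w k) :
    ∃ c', PC G D x v c' ∧ c' x w = k ∧ c' x v = 0 ∧ (∀ u, u ≠ w → u ≠ v → c' x u = c x u) ∧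
      (∀ a b, a ≠ x → b ≠ x → c' a b = c a b) ∧ Mis D c' v k ∧
      (∀ l, Mis D c x l → Mis D c' x l) := by
  have hs := h.symm
  have hxw := h.hxw.ne
  have hz := h.zero
  have hxv : G.Adj x v := h.adj x v (by omega)
  have hxv' := hxv.ne
  obtain ⟨h1, h2, hw⟩ := hw
  have hwv : w ≠ v := by rintro rfl; omega
  have hu : ∀ u, c x u = k → u = v := fun u hu => h.inj x u v (by omega) (by omega)
  have hu' : ∀ u, c v u = k → u = x := fun u hu =>
    h.inj v u x (by rw [hu, hs v x, hv]) (by omega)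
  refine ⟨setE (setE c x v 0) x w k, ⟨?_, ?_, ?_, ?_, ?_, ?_, hxv⟩, ?_, ?_, ?_, ?_, ?_, ?_⟩
  · intro a b
    have := hs a b
    unfold setE
    grind
  · intro a b
    have := h.le a b
    unfold setE
    split_ifs <;> omega
  · intro a b
    have := h.adj a b
    have := h.hxw
    have := h.hxw.symm
    unfold setE
    grind
  · intro p a b
    have := h.inj p a b
    have := hw a
    have := hw b
    unfold setE
    grind
  · unfold setE
    grind
  · intro a b hab
    have := h.nz a b hab
    unfold setE
    grind
  · unfold setE
    grind
  · unfold setE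
    grind
  · intro u hu1 hu2
    unfold setE
    grind
  · intro a b ha hb
    unfold setE
    grind
  · refine ⟨h1, h2, ?_⟩
    intro u
    unfold setE
    grind
  · rintro l ⟨l1, l2, l3⟩
    refine ⟨l1, l2, ?_⟩
    intro u
    have := l3 u
    have := l3 v
    unfold setE
    grind

theorem kempe_s10 {V : Type*} {G : SimpleGraph V} {D : ℕ} {x w t : V} {c : V → V → ℕ}
    (h : PC G D x w c) (hN : NF G D) {η τ : ℕ} (hw : Mis D c w η) (hx : Mis D c x τ)
    (htx : t ≠ x) (htw : t ≠ w) (ht : Mis D c t τ ∨ Mis D c t η) :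
    ∃ S : Set V, (∀ u v, (c u v = η ∨ c u v = τ) → u ∈ S → v ∈ S) ∧ t ∈ S ∧ x ∉ S ∧ w ∉ S := by
  have hne : η ≠ τ := by
    rintro rfl
    exact pc_fill h hN hx hw
  have hη : η ≠ 0 := by have := hw.1; omega
  have hτ : τ ≠ 0 := by have := hx.1; omega
  let K : SimpleGraph V :=
    { Adj := fun u v => c u v = η ∨ c u v = τ
      symm := ⟨fun u v huv => by rw [h.symm v u]; exact huv⟩
      loopless := ⟨fun u hu => (h.adj u u (by rcases hu with e | e <;> omega)).ne rfl⟩ }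
  have hK : ∀ u v, K.Adj u v ↔ (c u v = η ∨ c u v = τ) := fun _ _ => Iff.rfl
  have hcl : ∀ s u v, (c u v = η ∨ c u v = τ) → K.Reachable s u → K.Reachable s v := by
    intro s u v huv hr
    exact hr.trans (SimpleGraph.Adj.reachable ((hK u v).2 huv))
  have h2 : ∀ a b c d, K.Adj a b → K.Adj a c → K.Adj a d → b = c ∨ b = d ∨ c = d := by
    intro p q r s
    have e1 := h.inj p q r
    have e2 := h.inj p q s
    have e3 := h.inj p r s
    simp only [hK]
    grind
  have d1 : ∀ s, (Mis D c s τ ∨ Mis D c s η) → ∀ a b, K.Adj s a → K.Adj s b → a = b := by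
    intro s hs a b
    have e := h.inj s a b
    simp only [hK]
    rcases hs with ⟨-, -, hs⟩ | ⟨-, -, hs⟩
    · have := hs a
      have := hs b
      grind
    · have := hs a
      have := hs b
      grind
  -- `x` and `w` lie in the same component
  have hxw : K.Reachable x w := by
    by_contra hr
    have hp := pc_swap (S := {v | K.Reachable x v}) h ⟨hw.1, hw.2.1⟩ ⟨hx.1, hx.2.1⟩ (hcl x)
    refine pc_fill hp hN (k := η) ⟨hw.1, hw.2.1, ?_⟩ ⟨hw.1, hw.2.1, ?_⟩
    · intro u
      have := hx.2.2 u
      have hm : x ∈ {v | K.Reachable x v} := SimpleGraph.Reachable.refl x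
      unfold sw
      rw [if_pos hm]
      split_ifs <;> omega
    · intro u
      have hm : w ∉ {v | K.Reachable x v} := hr
      unfold sw
      rw [if_neg hm]
      exact hw.2.2 u
  have hxt : ¬ K.Reachable x t := by
    intro hr
    exact htw (reach_end_unique K h2 h.hxw.ne htx.symm (d1 x (Or.inl hx)) (d1 w (Or.inr hw))
      (d1 t ht) hxw hr).symm
  refine ⟨{v | K.Reachable t v}, hcl t, SimpleGraph.Reachable.refl t, ?_, ?_⟩
  · intro hr
    exact hxt (SimpleGraph.Reachable.symm hr)
  · intro hr
    exact hxt (hxw.trans (SimpleGraph.Reachable.symm hr))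

theorem op {V : Type*} {G : SimpleGraph V} {D : ℕ} {x w w' : V} {c : V → V → ℕ}
    (h : PC G D x w c) (hN : NF G D) {η τ k : ℕ} (hw : Mis D c w η) (hx : Mis D c x τ)
    (hw' : Mis D c w' τ) (hk : c w w' = k) (hk0 : k ≠ 0) :
    ∃ c', PC G D x w c' ∧ (∀ u, c' x u = c x u) ∧ c' w w' = η ∧
      (∀ u v, c u v ≠ η → c u v ≠ τ →
        (u = w ∧ v = w') ∨ (u = w' ∧ v = w) ∨ c' u v = c u v) ∧
      (∀ u v, c' u v ≠ η → c' u v ≠ τ → c u v = c' u v) ∧ Mis D c' w k := by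
  have hne : η ≠ τ := by
    rintro rfl
    exact pc_fill h hN hx hw
  have hz := h.zero
  have hxw' : w' ≠ x := by
    rintro rfl
    rw [h.symm] at hk
    omega
  have hww' : w' ≠ w := (h.adj w w' (by omega)).ne'
  obtain ⟨S, hS, hS1, hS2, hS3⟩ := kempe_s10 h hN hw hx hxw' hww' (Or.inl hw')
  have hkη : k ≠ η := fun e => hw.2.2 w' (by omega)
  have hkτ : k ≠ τ := fun e => hw'.2.2 w (by rw [h.symm]; omega)
  have p1 := pc_swap h ⟨hw.1, hw.2.1⟩ ⟨hx.1, hx.2.1⟩ hS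
  have e1 : sw c η τ S w w' = k := by
    unfold sw; rw [if_neg hS3]; exact hk
  have m1 : Mis D (sw c η τ S) w η := by
    refine ⟨hw.1, hw.2.1, fun u => ?_⟩
    unfold sw; rw [if_neg hS3]; exact hw.2.2 u
  have m2 : Mis D (sw c η τ S) w' η := by
    refine ⟨hw.1, hw.2.1, fun u => ?_⟩
    have := hw'.2.2 u
    unfold sw; rw [if_pos hS1]; split_ifs <;> omega
  have p2 := pc_set p1 (by omega) m1 m2
  have hxw := h.hxw.ne
  refine ⟨_, p2, ?_, ?_, ?_, ?_, ?_⟩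
  · intro u
    unfold setE sw
    grind
  · unfold setE
    simp
  · intro u v hu hv
    unfold setE sw
    grind
  · intro u v
    have := p1.symm w w'
    unfold setE
    split_ifs with hh
    · intro hc; exact absurd rfl hc
    · unfold sw
      split_ifs <;> omega
  · have hl := h.le w w'
    refine ⟨by omega, by omega, fun u => ?_⟩
    have := p1.inj w u w'
    unfold setE
    grind

theorem exists_common_s10 {V : Type*} [Fintype V] {G : SimpleGraph V} [DecidableRel G.Adj] {D : ℕ}
    {x w t : V} {c : V → V → ℕ} (h : PC G D x w c) (hd : G.degree t + G.degree x < D) (e : ℕ) :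
    ∃ τ, τ ≠ e ∧ Mis D c x τ ∧ Mis D c t τ := by
  classical
  let T : Finset ℕ := insert e (((G.neighborFinset x).erase w).image (c x) ∪
    (G.neighborFinset t).image (c t))
  have hcard : T.card < (Finset.Icc 1 D).card := by
    have hm : w ∈ G.neighborFinset x := by simpa using h.hxw
    have h1 : (((G.neighborFinset x).erase w).image (c x)).card ≤ G.degree x - 1 := by
      refine Finset.card_image_le.trans ?_
      rw [Finset.card_erase_of_mem hm, SimpleGraph.card_neighborFinset_eq_degree]
    have h2 : ((G.neighborFinset t).image (c t)).card ≤ G.degree t := by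
      refine Finset.card_image_le.trans ?_
      rw [SimpleGraph.card_neighborFinset_eq_degree]
    have h3 : 0 < G.degree x := by
      rw [← SimpleGraph.card_neighborFinset_eq_degree]
      exact Finset.card_pos.2 ⟨w, hm⟩
    have h4 := Finset.card_insert_le e (((G.neighborFinset x).erase w).image (c x) ∪
      (G.neighborFinset t).image (c t))
    have h5 := Finset.card_union_le (((G.neighborFinset x).erase w).image (c x))
      ((G.neighborFinset t).image (c t))
    rw [Nat.card_Icc]
    show (insert e _ : Finset ℕ).card < _
    omega
  obtain ⟨τ, hτ, hτ'⟩ := Finset.exists_mem_notMem_of_card_lt_card hcard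
  rw [Finset.mem_Icc] at hτ
  simp only [T, Finset.mem_insert, Finset.mem_union, Finset.mem_image, Finset.mem_erase,
    SimpleGraph.mem_neighborFinset, not_or, not_exists, not_and] at hτ'
  refine ⟨τ, hτ'.1, ⟨hτ.1, hτ.2, fun u hu => ?_⟩, ⟨hτ.1, hτ.2, fun u hu => ?_⟩⟩
  · have hz := h.zero
    exact hτ'.2.1 u ⟨by rintro rfl; omega, h.adj x u (by omega)⟩ hu
  · exact hτ'.2.2 u (h.adj t u (by omega)) hu

theorem exists_missing {V : Type*} [Fintype V] {G : SimpleGraph V} [DecidableRel G.Adj] {D : ℕ}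
    {x w : V} {c : V → V → ℕ} (h : PC G D x w c) (hd : G.degree w ≤ D) :
    ∃ τ, Mis D c w τ := by
  classical
  have hm : x ∈ G.neighborFinset w := by simpa using h.hxw.symm
  have hcard : (((G.neighborFinset w).erase x).image (c w)).card < (Finset.Icc 1 D).card := by
    refine Finset.card_image_le.trans_lt ?_
    rw [Finset.card_erase_of_mem hm, SimpleGraph.card_neighborFinset_eq_degree, Nat.card_Icc]
    have h3 : 0 < G.degree w := by
      rw [← SimpleGraph.card_neighborFinset_eq_degree]
      exact Finset.card_pos.2 ⟨x, hm⟩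
    omega
  obtain ⟨τ, hτ, hτ'⟩ := Finset.exists_mem_notMem_of_card_lt_card hcard
  rw [Finset.mem_Icc] at hτ
  simp only [Finset.mem_image, Finset.mem_erase,
    SimpleGraph.mem_neighborFinset, not_exists, not_and] at hτ'
  refine ⟨τ, hτ.1, hτ.2, fun u hu => ?_⟩
  have hz := h.zero
  have hs := h.symm w x
  exact hτ' u ⟨by rintro rfl; omega, h.adj w u (by omega)⟩ hu

theorem core {V : Type*} [Fintype V] {G : SimpleGraph V} [DecidableRel G.Adj] {D : ℕ}
    {x w w' v : V} {c : V → V → ℕ} (h : PC G D x w c) (hN : NF G D) {β β' : ℕ}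
    (hw : Mis D c w β) (hww' : c w w' = β') (hxv : c x v = β') (h0 : β' ≠ 0)
    (hlw : G.degree w' + G.degree x < D)
    (hv : Mis D c v β ∨ ∃ v', c v v' = β ∧ G.degree v' + G.degree x < D) : False := by
  have hz := h.zero
  have hs := h.symm
  have hvw : v ≠ w := by rintro rfl; omega
  have hvx : v ≠ x := (h.adj x v (by omega)).ne'
  have hββ' : β ≠ β' := by rintro rfl; exact hw.2.2 _ hww'
  have hβ0 : β ≠ 0 := by have := hw.1; omega
  rcases hv with hv | ⟨v', hv', hlv⟩
  · obtain ⟨τ, -, hτx, -⟩ := exists_common_s10 h hlw 0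
    have hβτ : β ≠ τ := by rintro rfl; exact pc_fill h hN hτx hw
    have hβ'τ : β' ≠ τ := by rintro rfl; exact hτx.2.2 _ hxv
    obtain ⟨S, hS, hS1, hS2, hS3⟩ := kempe_s10 h hN hw hτx hvx hvw (Or.inr hv)
    have p1 := pc_swap h ⟨hw.1, hw.2.1⟩ ⟨hτx.1, hτx.2.1⟩ hS
    have rowx : ∀ u, sw c β τ S x u = c x u := fun u => by unfold sw; rw [if_neg hS2]
    have roww : ∀ u, sw c β τ S w u = c w u := fun u => by unfold sw; rw [if_neg hS3]
    have mv : ∀ u, sw c β τ S v u ≠ τ := by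
      intro u
      have := hv.2.2 u
      unfold sw; rw [if_pos hS1]; split_ifs <;> omega
    generalize sw c β τ S = c1 at p1 rowx roww mv
    obtain ⟨τ1, hne, h1x, h1w⟩ := exists_common_s10 p1 hlw τ
    obtain ⟨c2, p2, rx, e2, o4, o5, m2⟩ := op p1 hN (η := β) (k := β')
      ⟨hw.1, hw.2.1, fun u => by rw [roww]; exact hw.2.2 u⟩ h1x h1w (by rw [roww, hww']) h0
    obtain ⟨c3, p3, -, s2, s3, s4, -, s6⟩ := pc_shift p2 (v := v) (k := β')
      (by rw [rx, rowx, hxv]) h0 m2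
    refine pc_fill p3 hN (k := τ) (s6 _ ⟨hτx.1, hτx.2.1, fun u => ?_⟩)
      ⟨hτx.1, hτx.2.1, fun u => ?_⟩
    · rw [rx, rowx]; exact hτx.2.2 u
    · intro e
      by_cases hu : u = x
      · subst hu
        rw [p3.symm, s2] at e
        have := hτx.1
        omega
      · rw [s4 _ _ hvx hu] at e
        have := o5 v u (by omega) (by omega)
        exact mv u (by omega)
  · have hv'w : v' ≠ w := by rintro rfl; exact hw.2.2 v (by rw [hs]; exact hv')
    have hv'x : v' ≠ x := by rintro rfl; rw [hs] at hv'; omega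
    have hvv' : v' ≠ v := (h.adj v v' (by omega)).ne'
    obtain ⟨τ4, -, h4x, h4v⟩ := exists_common_s10 h hlv 0
    obtain ⟨τ3, h34, h3x, h3v⟩ := exists_common_s10 h hlv τ4
    have hβ3 : β ≠ τ3 := by rintro rfl; exact pc_fill h hN h3x hw
    have hβ4 : β ≠ τ4 := by rintro rfl; exact pc_fill h hN h4x hw
    have hβ'3 : β' ≠ τ3 := by rintro rfl; exact h3x.2.2 _ hxv
    have hβ'4 : β' ≠ τ4 := by rintro rfl; exact h4x.2.2 _ hxv
    obtain ⟨S, hS, hS1, hS2, hS3⟩ := kempe_s10 h hN hw h3x hv'x hv'w (Or.inl h3v)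
    have hvS : v ∈ S := hS v' v (Or.inl (by rw [hs]; exact hv')) hS1
    have p1 := pc_swap h ⟨hw.1, hw.2.1⟩ ⟨h3x.1, h3x.2.1⟩ hS
    have rowx : ∀ u, sw c β τ3 S x u = c x u := fun u => by unfold sw; rw [if_neg hS2]
    have roww : ∀ u, sw c β τ3 S w u = c w u := fun u => by unfold sw; rw [if_neg hS3]
    have mv : ∀ u, sw c β τ3 S v' u ≠ β ∧ sw c β τ3 S v' u ≠ τ4 := by
      intro u
      have := h3v.2.2 u
      have := h4v.2.2 u
      unfold sw; rw [if_pos hS1]; split_ifs <;> omega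
    have ev : sw c β τ3 S v v' = τ3 := by
      unfold sw; rw [if_pos hvS, if_pos hv']
    generalize sw c β τ3 S = c1 at p1 rowx roww mv ev
    obtain ⟨τ1, hne, h1x, h1w⟩ := exists_common_s10 p1 hlw τ3
    obtain ⟨c2, p2, rx, e2, o4, o5, m2⟩ := op p1 hN (η := β) (k := β')
      ⟨hw.1, hw.2.1, fun u => by rw [roww]; exact hw.2.2 u⟩ h1x h1w (by rw [roww, hww']) h0
    have ev2 : c2 v v' = τ3 := by
      rcases o4 v v' (by omega) (by omega) with ⟨e, -⟩ | ⟨-, e⟩ | e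
      · exact absurd e hvw
      · exact absurd e hv'w
      · omega
    have m4 : ∀ u, c2 v' u ≠ τ4 := by
      intro u e
      by_cases h14 : τ4 = τ1
      · rcases o4 v' u (mv u).1 (by rw [← h14]; exact (mv u).2) with ⟨e', -⟩ | ⟨e', e''⟩ | e'
        · exact hv'w e'
        · subst e'; subst e''
          rw [p2.symm] at e
          omega
        · exact (mv u).2 (by omega)
      · have := o5 v' u (by omega) (by omega)
        exact (mv u).2 (by omega)
    obtain ⟨c3, p3, -, s2, s3, s4, s5, s6⟩ := pc_shift p2 (v := v) (k := β')
      (by rw [rx, rowx, hxv]) h0 m2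
    have m3x : Mis D c3 x τ3 := s6 _ ⟨h3x.1, h3x.2.1, fun u => by
      rw [rx, rowx]; exact h3x.2.2 u⟩
    have m4x : Mis D c3 x τ4 := s6 _ ⟨h4x.1, h4x.2.1, fun u => by
      rw [rx, rowx]; exact h4x.2.2 u⟩
    have m4v : Mis D c3 v' τ4 := by
      refine ⟨h4x.1, h4x.2.1, fun u e => ?_⟩
      by_cases hu : u = x
      · subst hu
        rw [p3.symm, s3 _ hv'w hvv', p2.symm] at e
        exact m4 _ e
      · rw [s4 _ _ hv'x hu] at e
        exact m4 _ e
    obtain ⟨c4, p4, rx4, -, -, -, m5⟩ := op p3 hN (k := τ3) s5 m4x m4v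
      (by rw [s4 _ _ hvx hv'x]; exact ev2) (by have := h3x.1; omega)
    exact pc_fill p4 hN ⟨m3x.1, m3x.2.1, fun u => by rw [rx4]; exact m3x.2.2 u⟩ m5

/-- Let `G` be a `Δ`-critical simple graph, `ε ∈ (0,1)`, `q = (1-ε)Δ`, `xy ∈ E(G)` with
`d(x) < εΔ`, and `φ ∈ C^Δ(G - xy)`. Suppose `z ∈ N(x, M_φ)`, `β ∈ φ_b(z) ∩ B_φ(x,y,q)`,
and `w ∈ N(x, B_φ)` with `φ(xw) = β`. Let
`B_w(φ) = {φ(ww') : w' ∈ N(w), φ(ww') ∈ B_φ(x,y,q) - {β}, d(w') < q}`. Then for every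
`β' ∈ B_w(φ)` there exist `z' ∈ N(x, B_φ)` and `u ∈ N(z')` such that `φ(xz') = β'`,
`φ(z'u) = β`, and `d(u) ≥ q`. -/
theorem statement10 (G : SimpleGraph V) [DecidableRel G.Adj] (hG : IsDeltaCritical G)
    (ε : ℝ) (hε : ε ∈ Set.Ioo (0 : ℝ) 1) (q : ℝ) (hq : q = (1 - ε) * G.maxDegree)
    (x y : V) (hxy : G.Adj x y) (hx : (G.degree x : ℝ) < ε * G.maxDegree)
    (H : SimpleGraph V) (hH : H = G.deleteEdges {s(x, y)})
    (φ : V → V → ℕ) (hφ : IsEdgeColoring H G.maxDegree φ)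
    (z : V) (hz : z ∈ NxM G H G.maxDegree φ q x y)
    (β : ℕ) (hβ : β ∈ phib G H G.maxDegree φ q z ∩ Bset G H φ q x y)
    (w : V) (hw : w ∈ NxB G H φ q x y) (hwβ : φ x w = β)
    (Bw : Set ℕ)
    (hBw : Bw = {c | ∃ w', H.Adj w w' ∧ φ w w' = c ∧
      c ∈ Bset G H φ q x y \ {β} ∧ (G.degree w' : ℝ) < q}) :
    ∀ β' ∈ Bw, ∃ z' u : V, z' ∈ NxB G H φ q x y ∧ G.Adj z' u ∧
      φ x z' = β' ∧ φ z' u = β ∧ q ≤ (G.degree u : ℝ) := by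
  classical
  intro β' hβ'
  subst hBw
  obtain ⟨w', hww', hφw', ⟨hβ'B, hβ'β⟩, hw'q⟩ := hβ'
  obtain ⟨⟨v, hxv, hφv⟩, u2, hyu2, hφu2, hu2q⟩ := hβ'B
  obtain ⟨hβb, hβx, u1, hyu1, hφu1, hu1q⟩ := hβ
  obtain ⟨hxw, hwB⟩ := hw
  obtain ⟨hxz, hzM⟩ := hz
  obtain ⟨hs, hr, hp⟩ := hφ
  have hβ'β : β' ≠ β := hβ'β
  by_contra hcon
  have hHG : ∀ a b, H.Adj a b → G.Adj a b := by
    intro a b hab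
    rw [hH, SimpleGraph.deleteEdges_adj] at hab
    exact hab.1
  have hlow : ∀ t, (G.degree t : ℝ) < q → G.degree t + G.degree x < G.maxDegree := by
    intro t ht
    have : (G.degree t : ℝ) + G.degree x < G.maxDegree := by
      rw [hq] at ht; linarith
    exact_mod_cast this
  have hvlow : ∀ u, H.Adj v u → φ v u = β → (G.degree u : ℝ) < q := by
    intro u hu e
    by_contra hge
    push Not at hge
    exact hcon ⟨v, u, ⟨hxv, by rw [hφv]; exact ⟨⟨v, hxv, hφv⟩, u2, hyu2, hφu2, hu2q⟩⟩,
      hHG _ _ hu, hφv, e, hge⟩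
  have hN : NF G G.maxDegree := by
    intro c hc
    have h1 : chromIndex G ≤ G.maxDegree := Nat.sInf_le ⟨c, hc⟩
    have := hG.2.1
    omega
  have hnxy : ¬ H.Adj x y := by
    rw [hH, SimpleGraph.deleteEdges_adj]
    simp
  obtain ⟨c, hc⟩ : ∃ c : V → V → ℕ, c = fun u v => if H.Adj u v then φ u v else 0 := ⟨_, rfl⟩
  have hcpos : ∀ u v, H.Adj u v → c u v = φ u v := by
    intro u v huv; rw [hc]; simp [huv]
  have hcz : ∀ u v, ¬ H.Adj u v → c u v = 0 := by
    intro u v huv; rw [hc]; simp [huv]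
  have hφr : ∀ u v, H.Adj u v → 1 ≤ φ u v ∧ φ u v ≤ G.maxDegree := by
    intro u v huv
    simpa using hr huv
  have hcadj : ∀ u v, c u v ≠ 0 → H.Adj u v := by
    intro u v h; by_contra hh; exact h (hcz u v hh)
  have pc : PC G G.maxDegree x y c := by
    refine ⟨?_, ?_, ?_, ?_, hcz _ _ hnxy, ?_, hxy⟩
    · intro u v
      by_cases h : H.Adj u v
      · rw [hcpos _ _ h, hcpos _ _ h.symm, hs]
      · rw [hcz _ _ h, hcz _ _ (fun h' => h h'.symm)]
    · intro u v
      by_cases h : H.Adj u v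
      · rw [hcpos _ _ h]; exact (hφr _ _ h).2
      · rw [hcz _ _ h]; omega
    · intro u v h
      exact hHG _ _ (hcadj _ _ h)
    · intro t a b e h
      by_contra hab
      have h1 := hcadj _ _ h
      have h2 := hcadj t b (by omega)
      rw [hcpos _ _ h1, hcpos _ _ h2] at e
      exact hp h1 h2 hab e
    · intro u v huv e
      have : ¬ H.Adj u v := by
        intro h
        have := hφr _ _ h
        rw [hcpos _ _ h] at e
        omega
      rw [hH, SimpleGraph.deleteEdges_adj] at this
      simp only [Set.mem_singleton_iff, not_and, not_not] at this
      have := this huv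
      simpa [Sym2.eq_iff] using this
  have mis_of : ∀ t k, 1 ≤ k → k ≤ G.maxDegree → k ∉ present H φ t →
      Mis G.maxDegree c t k := by
    intro t k h1 h2 h3
    refine ⟨h1, h2, fun u e => h3 ⟨u, hcadj t u (by omega), ?_⟩⟩
    rw [← hcpos _ _ (hcadj t u (by omega)), e]
  have cxz := hcpos _ _ hxz
  have cxw : c x w = β := by rw [hcpos _ _ hxw, hwβ]
  have cxv : c x v = β' := by rw [hcpos _ _ hxv, hφv]
  have cww' : c w w' = β' := by rw [hcpos _ _ hww', hφw']
  have cy1 : c y u1 = β := by rw [hcpos _ _ hyu1, hφu1]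
  have cy2 : c y u2 = β' := by rw [hcpos _ _ hyu2, hφu2]
  have hβ0 : β ≠ 0 := by have := hφr _ _ hxw; omega
  have hβ'0 : β' ≠ 0 := by have := hφr _ _ hxv; omega
  have hαr := hφr _ _ hxz
  obtain ⟨α, hα⟩ : ∃ α, α = φ x z := ⟨_, rfl⟩
  rw [← hα] at cxz hzM hαr
  have hα0 : α ≠ 0 := by omega
  -- Step 0: make `α` missing at `y`.
  have step0 : ∃ c0, PC G G.maxDegree x y c0 ∧ Mis G.maxDegree c0 y α ∧
      (∀ u, c0 x u = c x u) ∧ (∀ u v, c0 u v = β ↔ c u v = β) ∧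
      (∀ u v, c0 u v = β' ↔ c u v = β') ∧ α ≠ β ∧ α ≠ β' := by
    rcases hzM with (hA | hX) | hY
    · obtain ⟨-, u, hyu, hφu, huq⟩ := hA
      have cyu : c y u = α := by rw [hcpos _ _ hyu, hφu]
      have hαβ : α ≠ β := by
        intro e
        have := pc.inj y u u1 (by omega) (by omega)
        subst this
        linarith
      have hαβ' : α ≠ β' := by
        intro e
        have := pc.inj y u u2 (by omega) (by omega)
        subst this
        linarith
      obtain ⟨η, hη⟩ := exists_missing pc (G.degree_le_maxDegree y)
      obtain ⟨τ, -, hτx, hτu⟩ := exists_common_s10 pc (hlow u huq) 0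
      obtain ⟨c0, p0, rx, e0, o4, o5, m0⟩ := op pc hN hη hτx hτu cyu hα0
      have key : ∀ l, l ≠ η → l ≠ τ → l ≠ α → ∀ a b, c0 a b = l ↔ c a b = l := by
        intro l h1 h2 h3 a b
        constructor
        · intro e
          rw [o5 a b (by omega) (by omega), e]
        · intro e
          rcases o4 a b (by omega) (by omega) with ⟨rfl, rfl⟩ | ⟨rfl, rfl⟩ | e'
          · omega
          · rw [pc.symm] at e; omega
          · omega
      refine ⟨c0, p0, m0, rx, key β ?_ ?_ hαβ.symm, key β' ?_ ?_ hαβ'.symm, hαβ, hαβ'⟩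
      · rintro rfl; exact hη.2.2 _ cy1
      · rintro rfl; exact hτx.2.2 _ cxw
      · rintro rfl; exact hη.2.2 _ cy2
      · rintro rfl; exact hτx.2.2 _ cxv
    · exact absurd ⟨z, hxz, hα.symm⟩ hX.2
    · have m := mis_of y α hY.1.1 hY.1.2 hY.2
      refine ⟨c, pc, m, fun _ => rfl, fun _ _ => Iff.rfl, fun _ _ => Iff.rfl, ?_, ?_⟩
      · rintro rfl; exact m.2.2 _ cy1
      · rintro rfl; exact m.2.2 _ cy2
  obtain ⟨c0, p0, m0, r0, b0, b0', hαβ, hαβ'⟩ := step0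
  -- Step 1: shift to `xz`.
  obtain ⟨c1, p1, -, s2, s3, s4, s5, s6⟩ := pc_shift p0 (v := z) (by rw [r0, cxz]) hα0 m0
  have hzx : z ≠ x := hxz.ne'
  have hwx : w ≠ x := hxw.ne'
  have hvx : v ≠ x := hxv.ne'
  have hwz : w ≠ z := by rintro rfl; omega
  have hvz : v ≠ z := by rintro rfl; omega
  have hvw : v ≠ w := by rintro rfl; omega
  have hwy : w ≠ y := by rintro rfl; exact hnxy hxw
  have hvy : v ≠ y := by rintro rfl; exact hnxy hxv
  have hw'x : w' ≠ x := by
    rintro rfl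
    rw [pc.symm] at cww'
    omega
  have xw1 : c1 x w = β := by rw [s3 _ hwy hwz, r0, cxw]
  have xv1 : c1 x v = β' := by rw [s3 _ hvy hvz, r0, cxv]
  -- Step 2: make `β` missing at `z`.
  have step2 : ∃ c2, PC G G.maxDegree x z c2 ∧ Mis G.maxDegree c2 z β ∧
      (∀ u, c2 x u = c1 x u) ∧ (∀ u v, c2 u v = β → c1 u v = β) ∧
      (∀ u v, c1 u v = β' → c2 u v = β') := by
    by_cases hm : Mis G.maxDegree c1 z β
    · exact ⟨c1, p1, hm, fun _ => rfl, fun _ _ h => h, fun _ _ h => h⟩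
    · have : ∃ u, c1 z u = β := by
        by_contra hno
        push Not at hno
        exact hm ⟨hβb.1.1, hβb.1.2, hno⟩
      obtain ⟨u, hu⟩ := this
      have hux : u ≠ x := by
        rintro rfl
        rw [p1.symm] at hu
        omega
      have czu : c z u = β := by
        rw [← b0, ← s4 _ _ hzx hux]; exact hu
      have hzu := hcadj z u (by omega)
      have hulow : (G.degree u : ℝ) < q := by
        rcases hβb.2 with h | ⟨u', h1, h2, h3⟩
        · exact absurd ⟨u, hzu, by rw [← hcpos _ _ hzu, czu]⟩ h
        · have := pc.inj z u u' (by rw [czu, hcpos _ _ h1, h2]) (by omega)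
          rw [this]; exact h3
      obtain ⟨τ, -, hτx, hτu⟩ := exists_common_s10 p1 (hlow u hulow) 0
      obtain ⟨c2, p2, rx, e2, o4, o5, m2⟩ := op p1 hN s5 hτx hτu hu hβ0
      have hτβ : τ ≠ β := by rintro rfl; exact hτx.2.2 _ xw1
      have hτβ' : τ ≠ β' := by rintro rfl; exact hτx.2.2 _ xv1
      refine ⟨c2, p2, m2, rx, ?_, ?_⟩
      · intro a b e
        rw [o5 a b (by omega) (by omega), e]
      · intro a b e
        rcases o4 a b (by omega) (by omega) with ⟨rfl, rfl⟩ | ⟨rfl, rfl⟩ | e'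
        · omega
        · rw [p1.symm] at e; omega
        · omega
  obtain ⟨c2, p2, m2, r2, b2, b2'⟩ := step2
  -- Step 3: shift to `xw`.
  obtain ⟨c3, p3, -, t2, t3, t4, t5, t6⟩ := pc_shift p2 (v := w) (by rw [r2, xw1]) hβ0 m2
  refine core p3 hN (w' := w') (v := v) (β := β) (β' := β') t5 ?_ ?_ hβ'0 (hlow w' hw'q) ?_
  · rw [t4 _ _ hwx hw'x]
    apply b2'
    rw [s4 _ _ hwx hw'x, b0']
    exact cww'
  · rw [t3 _ hvz hvw, r2, xv1]
  · by_cases hm : ∃ u, c3 v u = β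
    · right
      obtain ⟨u, hu⟩ := hm
      refine ⟨u, hu, hlow u ?_⟩
      have hux : u ≠ x := by
        rintro rfl
        rw [p3.symm, t3 _ hvz hvw, r2, xv1] at hu
        omega
      rw [t4 _ _ hvx hux] at hu
      have hu := b2 _ _ hu
      rw [s4 _ _ hvx hux, b0] at hu
      have hvu := hcadj v u (by omega)
      exact hvlow u hvu (by rw [← hcpos _ _ hvu, hu])
    · left
      push Not at hm
      exact ⟨hβb.1.1, hβb.1.2, hm⟩
end
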